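/- arXiv:1801.05992 — 2 statements merged into one kernel-verified Lean document; each statement's English description precedes it below -/
import Mathlib

section
/- In any realization of the double ring convex geometry (D_{2k}, C_{2k}) in the plane, for each i, each open half-plane bounded by the line through r_i and r'_i contains exactly k−1 of the pairs {r_j, r'_j}, and the points strictly on one side together with r_i form one of the two maximal convexly closed sets containing r_i but not r'_i. -/
/-- The orientation of an ordered triple of planar points: the sign of the
determinant of the 3×3 matrix of homogeneous coordinates. -/
noncomputable def orient (p q r : ℝ × ℝ) : ℝ :=
  Real.sign (Matrix.det !![p.1, p.2, 1; q.1, q.2, 1; r.1, r.2, 1])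

theorem real_sign_eq_one_iff {a : ℝ} : Real.sign a = 1 ↔ 0 < a := by
  refine ⟨fun h => ?_, Real.sign_of_pos⟩
  rcases lt_trichotomy a 0 with h' | rfl | h'
  · rw [Real.sign_of_neg h'] at h
    norm_num at h
  · simp at h
  · exact h'

theorem real_sign_eq_neg_one_iff {a : ℝ} : Real.sign a = -1 ↔ a < 0 := by
  rw [← neg_pos, ← real_sign_eq_one_iff, Real.sign_neg, neg_eq_iff_eq_neg]

theorem real_sign_mul_of_pos {a b : ℝ} (ha : 0 < a) : Real.sign (a * b) = Real.sign b := by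
  rcases lt_trichotomy b 0 with h | rfl | h
  · rw [Real.sign_of_neg h, Real.sign_of_neg (mul_neg_of_pos_of_neg ha h)]
  · rw [mul_zero]
  · rw [Real.sign_of_pos h, Real.sign_of_pos (mul_pos ha h)]

/-- The affine function whose sign is `orient p q`. -/
noncomputable def orientDet (p q x : ℝ × ℝ) : ℝ :=
  (q.1 - p.1) * (x.2 - p.2) - (q.2 - p.2) * (x.1 - p.1)

theorem orient_eq_sign_orientDet (p q x : ℝ × ℝ) :
    orient p q x = Real.sign (orientDet p q x) := by
  unfold orient orientDet
  congr 1
  simp [Matrix.det_fin_three]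
  ring

theorem orientDet_left (p q : ℝ × ℝ) : orientDet p q p = 0 := by
  simp [orientDet]

theorem orientDet_right (p q : ℝ × ℝ) : orientDet p q q = 0 := by
  simp [orientDet]; ring

theorem orientDet_combo (p q x y : ℝ × ℝ) {a b : ℝ} (hab : a + b = 1) :
    orientDet p q (a • x + b • y) = a * orientDet p q x + b * orientDet p q y := by
  obtain rfl : b = 1 - a := by linarith
  simp [orientDet]; ring

/-- An open half-plane together with one point of its boundary line is convex. -/
theorem convex_insert_halfplane (p q : ℝ × ℝ) (s : ℝ) :
    Convex ℝ {x | x = p ∨ 0 < s * orientDet p q x} := by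
  intro x hx y hy a b ha hb hab
  have hp : s * orientDet p q p = 0 := by simp [orientDet_left]
  have key : s * orientDet p q (a • x + b • y) =
      a * (s * orientDet p q x) + b * (s * orientDet p q y) := by
    rw [orientDet_combo p q x y hab]; ring
  simp only [Set.mem_ofPred_eq] at hx hy ⊢
  rw [key]
  rcases ha.eq_or_lt with rfl | ha'
  · obtain rfl : b = 1 := by linarith
    simpa using hy
  rcases hb.eq_or_lt with rfl | hb'
  · obtain rfl : a = 1 := by linarith
    simpa using hx
  rcases hx with rfl | hx <;> rcases hy with rfl | hy
  · left; rw [← add_smul, hab, one_smul]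
  · right; rw [hp]; nlinarith [mul_pos hb' hy]
  · right; rw [hp]; nlinarith [mul_pos ha' hx]
  · right; nlinarith [mul_pos ha' hx, mul_pos hb' hy]

theorem mem_convexHull_triple {E : Type*} [AddCommGroup E] [Module ℝ E] {p x y z : E} :
    z ∈ convexHull ℝ {p, x, y} ↔ ∃ a b c : ℝ, 0 ≤ a ∧ 0 ≤ b ∧ 0 ≤ c ∧ a + b + c = 1 ∧
      a • p + b • x + c • y = z := by
  constructor
  · rw [convexHull_insert (Set.insert_nonempty _ _), convexHull_pair, mem_convexJoin]
    rintro ⟨u, rfl, w, ⟨b, c, hb, hc, hbc, rfl⟩, a, d, ha, hd, had, rfl⟩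
    refine ⟨a, d * b, d * c, ha, mul_nonneg hd hb, mul_nonneg hd hc, ?_, ?_⟩
    · rw [add_assoc, ← mul_add, hbc, mul_one, had]
    · rw [smul_add, mul_smul, mul_smul, add_assoc]
  · rintro ⟨a, b, c, ha, hb, hc, habc, rfl⟩
    have hconv := convex_convexHull ℝ ({p, x, y} : Set E)
    have hsub := subset_convexHull ℝ ({p, x, y} : Set E)
    have := hconv.sum_mem (t := Finset.univ) (w := ![a, b, c]) (z := ![p, x, y])
      (by intro i _; fin_cases i <;> simpa) (by simp [Fin.sum_univ_three, habc])
      (by intro i _; apply hsub; fin_cases i <;> simp)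
    simpa [Fin.sum_univ_three] using this

/-- Three collinear distinct points: one of them lies between the other two. -/
theorem mem_segment_of_orientDet_eq_zero {p q x : ℝ × ℝ} (hpq : p ≠ q)
    (h : orientDet p q x = 0) :
    x ∈ segment ℝ p q ∨ p ∈ segment ℝ q x ∨ q ∈ segment ℝ p x := by
  obtain ⟨t, rfl⟩ : ∃ t : ℝ, x = p + t • (q - p) := by
    unfold orientDet at h
    by_cases h1 : q.1 - p.1 = 0
    · have h2 : q.2 - p.2 ≠ 0 := by
        intro h2
        exact hpq (Prod.ext (by linarith) (by linarith))
      refine ⟨(x.2 - p.2) / (q.2 - p.2), Prod.ext ?_ ?_⟩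
      · rw [h1, zero_mul, zero_sub, neg_eq_zero, mul_eq_zero] at h
        simp only [Prod.fst_add, Prod.smul_fst, Prod.fst_sub, smul_eq_mul, h1]
        have := h.resolve_left h2
        linarith
      · simp [h2]
    · refine ⟨(x.1 - p.1) / (q.1 - p.1), Prod.ext ?_ ?_⟩
      · simp [h1]
      · simp only [Prod.snd_add, Prod.smul_snd, Prod.snd_sub, smul_eq_mul]
        field_simp
        linarith
  rcases le_or_gt t 0 with ht | ht
  · right; left
    have : 0 < 1 - t := by linarith
    refine ⟨-t / (1 - t), 1 / (1 - t), by apply div_nonneg <;> linarith, by positivity,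
      by field_simp; ring, ?_⟩
    ext <;> simp <;> field_simp <;> ring
  rcases le_or_gt t 1 with ht1 | ht1
  · left
    exact ⟨1 - t, t, by linarith, ht.le, by ring, by ext <;> simp <;> ring⟩
  · right; right
    refine ⟨(t - 1) / t, 1 / t, by apply div_nonneg <;> linarith, by positivity,
      by field_simp; ring, ?_⟩
    ext <;> simp <;> field_simp <;> ring

/-- An isomorphism of the families of convexly closed sets transports convex hull membership. -/
theorem mem_convexHull_image_iff {D P : Set (ℝ × ℝ)} {f : ℝ × ℝ → ℝ × ℝ}
    (hf : Set.BijOn f D P)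
    (hiso : ∀ C ⊆ D, (convexHull ℝ C ∩ D = C ↔ convexHull ℝ (f '' C) ∩ P = f '' C))
    {C : Set (ℝ × ℝ)} (hC : C ⊆ D) {y : ℝ × ℝ} (hy : y ∈ D) :
    f y ∈ convexHull ℝ (f '' C) ↔ y ∈ convexHull ℝ C := by
  have closed_trace : ∀ S T : Set (ℝ × ℝ),
      convexHull ℝ (convexHull ℝ S ∩ T) ∩ T = convexHull ℝ S ∩ T := by
    intro S T
    apply Set.Subset.antisymm
    · exact Set.inter_subset_inter_left _
        (convexHull_min Set.inter_subset_left (convex_convexHull ℝ S))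
    · exact fun x hx => ⟨subset_convexHull ℝ _ hx, hx.2⟩
  constructor
  · intro h
    have hcl := (hiso (convexHull ℝ C ∩ D) Set.inter_subset_right).1 (closed_trace C D)
    have hmem : f y ∈ f '' (convexHull ℝ C ∩ D) := by
      rw [← hcl]
      refine ⟨convexHull_mono (Set.image_mono fun x hx => ?_) h, hf.mapsTo hy⟩
      exact ⟨subset_convexHull ℝ C hx, hC hx⟩
    obtain ⟨x, hx, hxy⟩ := hmem
    rw [← hf.injOn hx.2 hy hxy]
    exact hx.1
  · intro h
    set C₁ : Set (ℝ × ℝ) := {x ∈ D | f x ∈ convexHull ℝ (f '' C)}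
    have himg : f '' C₁ = convexHull ℝ (f '' C) ∩ P := by
      ext z
      constructor
      · rintro ⟨x, hx, rfl⟩
        exact ⟨hx.2, hf.mapsTo hx.1⟩
      · rintro ⟨hz, hzP⟩
        obtain ⟨x, hx, rfl⟩ := hf.surjOn hzP
        exact ⟨x, ⟨hx, hz⟩, rfl⟩
    have hcl : convexHull ℝ C₁ ∩ D = C₁ :=
      (hiso C₁ fun x hx => hx.1).2 (by rw [himg]; exact closed_trace _ _)
    have hmem : y ∈ C₁ := by
      rw [← hcl]
      refine ⟨convexHull_mono (fun x hx => ?_) h, hy⟩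
      exact ⟨hC hx, subset_convexHull ℝ _ (Set.mem_image_of_mem f hx)⟩
    exact hmem.2

/-- Suppose a line `g = 0` passes through `p, q ∈ D`, every other point of `D` on it lies behind `q`
as seen from `p`, and `q` lies in every triangle spanned by `p` and two points of `D` on opposite
sides.  Then a realization preserves, up to a global sign, the side of the line. -/
theorem exists_orient_eq_mul_sign {D P : Set (ℝ × ℝ)} {f : ℝ × ℝ → ℝ × ℝ}
    (hf : Set.BijOn f D P)
    (hiso : ∀ C ⊆ D, (convexHull ℝ C ∩ D = C ↔ convexHull ℝ (f '' C) ∩ P = f '' C))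
    {p q : ℝ × ℝ} (hp : p ∈ D) (hq : q ∈ D) (hpq : p ≠ q) (g : ℝ × ℝ →ₗ[ℝ] ℝ)
    (hgp : g p = 0) (hgq : g q = 0)
    (hzero : ∀ x ∈ D, g x = 0 → x = p ∨ q ∈ convexHull ℝ {p, x})
    (hcross : ∀ x ∈ D, ∀ y ∈ D, 0 < g x → g y < 0 → q ∈ convexHull ℝ {p, x, y})
    {a b : ℝ × ℝ} (ha : a ∈ D) (hb : b ∈ D) (hga : 0 < g a) (hgb : g b < 0) :
    ∃ τ : ℝ, (τ = 1 ∨ τ = -1) ∧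
      ∀ x ∈ D, orient (f p) (f q) (f x) = τ * Real.sign (g x) := by
  have hfpq : f p ≠ f q := fun h => hpq (hf.injOn hp hq h)
  have pair : ∀ x ∈ D, ∀ y ∈ D, ∀ z ∈ D,
      (f z ∈ segment ℝ (f x) (f y) ↔ z ∈ segment ℝ x y) := by
    intro x hx y hy z hz
    rw [← convexHull_pair, ← convexHull_pair, ← Set.image_pair]
    exact mem_convexHull_image_iff hf hiso (by
      rintro w (rfl | rfl) <;> assumption) hz
  set d : ℝ × ℝ → ℝ := fun x => orientDet (f p) (f q) (f x) with hd
  have dzero : ∀ x ∈ D, g x = 0 → d x = 0 := by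
    intro x hx hgx
    rcases hzero x hx hgx with rfl | h
    · exact orientDet_left _ _
    rw [convexHull_pair, ← pair p hp x hx q hq] at h
    obtain ⟨s, t, hs, ht, hst, h⟩ := h
    have h1 := orientDet_combo (f p) (f q) (f p) (f x) hst
    rw [h, orientDet_left, orientDet_right, mul_zero, zero_add] at h1
    rcases mul_eq_zero.1 h1.symm with rfl | h2
    · obtain rfl : s = 1 := by linarith
      exact absurd (by simpa using h) hfpq
    · exact h2
  have dne : ∀ x ∈ D, g x ≠ 0 → d x ≠ 0 := by
    intro x hx hgx hdx
    rcases mem_segment_of_orientDet_eq_zero hfpq hdx with h | h | h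
    · rw [pair p hp q hq x hx] at h
      obtain ⟨s, t, hs, ht, hst, rfl⟩ := h
      exact hgx (by simp [hgp, hgq])
    · rw [pair q hq x hx p hp] at h
      obtain ⟨s, t, hs, ht, hst, h⟩ := h
      have h1 := congrArg g h
      simp only [map_add, map_smul, hgp, hgq, smul_eq_mul, mul_zero, zero_add, mul_eq_zero, hgx,
        or_false] at h1
      obtain rfl : s = 1 := by linarith
      subst h1
      exact hpq (by simpa using h.symm)
    · rw [pair p hp x hx q hq] at h
      obtain ⟨s, t, hs, ht, hst, h⟩ := h
      have h1 := congrArg g h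
      simp only [map_add, map_smul, hgp, hgq, smul_eq_mul, mul_zero, zero_add, mul_eq_zero, hgx,
        or_false] at h1
      obtain rfl : s = 1 := by linarith
      subst h1
      exact hpq (by simpa using h)
  have dopp : ∀ x ∈ D, ∀ y ∈ D, 0 < g x → g y < 0 → d x * d y < 0 := by
    intro x hx y hy hgx hgy
    have hdx := dne x hx hgx.ne'
    have hdy := dne y hy hgy.ne
    have h := hcross x hx y hy hgx hgy
    rw [← mem_convexHull_image_iff hf hiso (by
      rintro w (rfl | rfl | rfl) <;> assumption) hq, Set.image_insert_eq, Set.image_pair,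
      mem_convexHull_triple] at h
    obtain ⟨u, v, w, hu, hv, hw, huvw, h⟩ := h
    have h1 : v * d x + w * d y = 0 := by
      have e1 := congrArg Prod.fst h
      have e2 := congrArg Prod.snd h
      simp only [Prod.fst_add, Prod.smul_fst, Prod.snd_add, Prod.smul_snd, smul_eq_mul] at e1 e2
      obtain rfl : u = 1 - v - w := by linarith
      simp only [hd, orientDet]
      linear_combination ((f q).1 - (f p).1) * e2 - ((f q).2 - (f p).2) * e1
    by_contra hcon
    have hpos : 0 < d x * d y := lt_of_le_of_ne (not_lt.1 hcon) (mul_ne_zero hdx hdy).symm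
    have hv0 : v = 0 := by
      have : v * (d x) ^ 2 + w * (d x * d y) = 0 := by linear_combination d x * h1
      have := mul_nonneg hw hpos.le
      have := mul_nonneg hv (sq_nonneg (d x))
      have h0 : v * (d x) ^ 2 = 0 := by linarith
      exact (mul_eq_zero.1 h0).resolve_right (pow_ne_zero 2 hdx)
    subst hv0
    rw [zero_mul, zero_add] at h1
    have hw0 : w = 0 := (mul_eq_zero.1 h1).resolve_right hdy
    subst hw0
    obtain rfl : u = 1 := by linarith
    exact hfpq (by simpa using h)
  simp only [orient_eq_sign_orientDet]
  rcases lt_or_gt_of_ne (dne a ha hga.ne') with hda | hda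
  · refine ⟨-1, Or.inr rfl, fun x hx => ?_⟩
    have hdb : 0 < d b := pos_of_mul_neg_right (dopp a ha b hb hga hgb) hda.le
    change Real.sign (d x) = _
    rcases lt_trichotomy (g x) 0 with hgx | hgx | hgx
    · have : 0 < d x := pos_of_mul_neg_right (dopp a ha x hx hga hgx) hda.le
      simp [Real.sign_of_pos this, Real.sign_of_neg hgx]
    · simp [hgx, dzero x hx hgx]
    · have : d x < 0 := neg_of_mul_neg_left (dopp x hx b hb hgx hgb) hdb.le
      simp [Real.sign_of_neg this, Real.sign_of_pos hgx]
  · refine ⟨1, Or.inl rfl, fun x hx => ?_⟩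
    have hdb : d b < 0 := neg_of_mul_neg_right (dopp a ha b hb hga hgb) hda.le
    change Real.sign (d x) = _
    rcases lt_trichotomy (g x) 0 with hgx | hgx | hgx
    · have : d x < 0 := neg_of_mul_neg_right (dopp a ha x hx hga hgx) hda.le
      simp [Real.sign_of_neg this, Real.sign_of_neg hgx]
    · simp [hgx, dzero x hx hgx]
    · have : 0 < d x := pos_of_mul_neg_left (dopp x hx b hb hgx hgb) hdb.le
      simp [Real.sign_of_pos this, Real.sign_of_pos hgx]

/-- If `q` blocks every point of `P` on the other side of, or on, the line through `p` and `q`,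
then the points strictly on one side together with `p` form a maximal convexly closed set
avoiding `q`. -/
theorem halfplane_isMaximal_closed {P : Set (ℝ × ℝ)} {p q : ℝ × ℝ} (hp : p ∈ P) (hq : q ∈ P)
    (hpq : p ≠ q) {s : ℝ} (hs : s = -1 ∨ s = 1)
    (hblock : ∀ x ∈ P, x ≠ p → orient p q x ≠ s →
      q ∈ convexHull ℝ ({x} ∪ ({p} ∪ {y ∈ P | orient p q y = s}))) :
    let C : Set (ℝ × ℝ) := {p} ∪ {x ∈ P | orient p q x = s}
    convexHull ℝ C ∩ P = C ∧ p ∈ C ∧ q ∉ C ∧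
      ∀ C' : Set (ℝ × ℝ), C ⊆ C' → C' ⊆ P → convexHull ℝ C' ∩ P = C' → q ∉ C' → C' = C := by
  intro C
  have side : ∀ x, orient p q x = s ↔ 0 < s * orientDet p q x := by
    intro x
    rw [orient_eq_sign_orientDet]
    rcases hs with rfl | rfl
    · rw [real_sign_eq_neg_one_iff, neg_one_mul, neg_pos]
    · rw [real_sign_eq_one_iff, one_mul]
  refine ⟨Set.Subset.antisymm ?_ ?_, Or.inl rfl, ?_, ?_⟩
  · rintro x ⟨hx, hxP⟩
    have hsub : C ⊆ {x | x = p ∨ 0 < s * orientDet p q x} := by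
      rintro y (hy | ⟨-, hy⟩)
      · exact Or.inl hy
      · exact Or.inr ((side y).1 hy)
    rcases convexHull_min hsub (convex_insert_halfplane p q s) hx with h | h
    · exact Or.inl h
    · exact Or.inr ⟨hxP, (side x).2 h⟩
  · rintro x hx
    refine ⟨subset_convexHull ℝ C hx, ?_⟩
    rcases hx with rfl | hx
    · exact hp
    · exact hx.1
  · rintro (h | ⟨-, h⟩)
    · exact hpq h.symm
    · rw [side, orientDet_right, mul_zero] at h
      exact lt_irrefl _ h
  · intro C' hCC' hC'P hcl hqC'
    refine Set.Subset.antisymm (fun x hx => ?_) hCC'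
    by_contra hxC
    apply hqC'
    rw [← hcl]
    refine ⟨convexHull_mono ?_ (hblock x (hC'P hx) (fun h => hxC (Or.inl h))
      fun h => hxC (Or.inr ⟨hC'P hx, h⟩)), hq⟩
    rintro y (rfl | hy)
    · exact hx
    · exact hCC' hy

/-- The angle of the `j`-th spoke. -/
noncomputable def spokeAngle (k : ℕ) (j : ZMod (2 * k)) : ℝ :=
  2 * Real.pi * (j.val : ℝ) / (2 * k)

theorem exists_spokeAngle_add_half {k : ℕ} (hk : 2 ≤ k) (j : ZMod (2 * k)) :
    ∃ c : ℕ, spokeAngle k j + Real.pi = spokeAngle k (j + k) + c * (2 * Real.pi) := by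
  have : NeZero (2 * k) := ⟨by omega⟩
  have hkR : (k : ℝ) ≠ 0 := by positivity
  refine ⟨(j.val + k) / (2 * k), ?_⟩
  have hval : (j + k).val = (j.val + k) % (2 * k) := by
    rw [ZMod.val_add, ZMod.val_natCast, Nat.mod_eq_of_lt (by omega : k < 2 * k)]
  have hdiv : ((j.val + k : ℕ) : ℝ) =
      ((j.val + k) % (2 * k) : ℕ) + 2 * k * ((j.val + k) / (2 * k) : ℕ) := by
    exact_mod_cast (Nat.mod_add_div (j.val + k) (2 * k)).symm
  push_cast at hdiv
  unfold spokeAngle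
  rw [hval]
  field_simp
  linear_combination hdiv

theorem cos_spokeAngle_add_half {k : ℕ} (hk : 2 ≤ k) (j : ZMod (2 * k)) :
    Real.cos (spokeAngle k (j + k)) = -Real.cos (spokeAngle k j) := by
  obtain ⟨c, hc⟩ := exists_spokeAngle_add_half hk j
  rw [← Real.cos_add_pi, hc, Real.cos_add_nat_mul_two_pi]

theorem sin_spokeAngle_add_half {k : ℕ} (hk : 2 ≤ k) (j : ZMod (2 * k)) :
    Real.sin (spokeAngle k (j + k)) = -Real.sin (spokeAngle k j) := by
  obtain ⟨c, hc⟩ := exists_spokeAngle_add_half hk j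
  rw [← Real.sin_add_pi, hc, Real.sin_add_nat_mul_two_pi]

theorem sin_spokeAngle_sub_add_half {k : ℕ} (hk : 2 ≤ k) (i j : ZMod (2 * k)) :
    Real.sin (spokeAngle k (j + k) - spokeAngle k i) =
      -Real.sin (spokeAngle k j - spokeAngle k i) := by
  rw [Real.sin_sub, Real.sin_sub, cos_spokeAngle_add_half hk, sin_spokeAngle_add_half hk]
  ring

theorem natCast_add_natCast_self (k : ℕ) : (k : ZMod (2 * k)) + k = 0 := by
  rw [← Nat.cast_add, ← two_mul, ZMod.natCast_self]

theorem sin_spokeAngle_sub_eq_zero_iff {k : ℕ} (hk : 2 ≤ k) (i j : ZMod (2 * k)) :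
    Real.sin (spokeAngle k j - spokeAngle k i) = 0 ↔ j = i ∨ j = i + k := by
  have : NeZero (2 * k) := ⟨by omega⟩
  have hkR : (k : ℝ) ≠ 0 := by positivity
  constructor
  · intro h
    obtain ⟨n, hn⟩ := Real.sin_eq_zero_iff.1 h
    have hint : (j.val : ℤ) = i.val + n * k := by
      unfold spokeAngle at hn
      field_simp at hn
      have : (j.val : ℝ) = i.val + n * k := by linarith
      exact_mod_cast this
    have hz := congrArg (Int.cast : ℤ → ZMod (2 * k)) hint
    push_cast at hz
    rw [ZMod.natCast_zmod_val, ZMod.natCast_zmod_val] at hz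
    have hkk := natCast_add_natCast_self k
    rcases Int.even_or_odd' n with ⟨m, rfl | rfl⟩
    · left
      push_cast at hz
      linear_combination hz + (m : ZMod (2 * k)) * hkk
    · right
      push_cast at hz
      linear_combination hz + (m : ZMod (2 * k)) * hkk
  · rintro (rfl | rfl)
    · simp
    · rw [sin_spokeAngle_sub_add_half hk]; simp

theorem ncard_sin_spokeAngle_pos_and_neg {k : ℕ} (hk : 2 ≤ k) (i : ZMod (2 * k)) :
    {j : ZMod (2 * k) | 0 < Real.sin (spokeAngle k j - spokeAngle k i)}.ncard = k - 1 ∧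
    {j : ZMod (2 * k) | Real.sin (spokeAngle k j - spokeAngle k i) < 0}.ncard = k - 1 := by
  have : NeZero (2 * k) := ⟨by omega⟩
  set A := {j : ZMod (2 * k) | 0 < Real.sin (spokeAngle k j - spokeAngle k i)}
  set B := {j : ZMod (2 * k) | Real.sin (spokeAngle k j - spokeAngle k i) < 0}
  have hAB : (fun j : ZMod (2 * k) => j + k) '' A = B := by
    ext j
    constructor
    · rintro ⟨l, hl, rfl⟩
      change Real.sin _ < 0
      rw [sin_spokeAngle_sub_add_half hk]
      exact neg_lt_zero.2 hl
    · intro hj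
      refine ⟨j + k, ?_, by simp only [add_assoc, natCast_add_natCast_self, add_zero]⟩
      change 0 < Real.sin _
      rw [sin_spokeAngle_sub_add_half hk]
      exact neg_pos.2 hj
  have hcard : B.ncard = A.ncard := by
    rw [← hAB, Set.ncard_image_of_injective _ (add_left_injective _)]
  have hne : i ≠ i + k := by
    intro h
    have h0 : (k : ZMod (2 * k)) = 0 := by simpa using h.symm
    rw [ZMod.natCast_eq_zero_iff] at h0
    exact absurd (Nat.le_of_dvd (by omega) h0) (by omega)
  have hunion : A ∪ B ∪ {i, i + k} = Set.univ := by
    ext j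
    simp only [Set.mem_union, Set.mem_insert_iff, Set.mem_singleton_iff, Set.mem_univ, iff_true,
      ← sin_spokeAngle_sub_eq_zero_iff hk i j, A, B, Set.mem_ofPred_eq]
    rcases lt_trichotomy (Real.sin (spokeAngle k j - spokeAngle k i)) 0 with h | h | h <;> simp [h]
  have hd1 : Disjoint A B := Set.disjoint_left.2 fun j h1 h2 => by
    simp only [A, B, Set.mem_ofPred_eq] at h1 h2
    exact lt_asymm h1 h2
  have hd2 : Disjoint (A ∪ B) {i, i + (k : ZMod (2 * k))} := by
    refine Set.disjoint_left.2 fun j h1 h2 => ?_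
    have h0 := (sin_spokeAngle_sub_eq_zero_iff hk i j).2 h2
    rcases h1 with h1 | h1
    · exact (ne_of_gt h1) h0
    · exact (ne_of_lt h1) h0
  have htotal := congrArg Set.ncard hunion
  rw [Set.ncard_union_eq hd2, Set.ncard_union_eq hd1, Set.ncard_pair hne, Set.ncard_univ,
    Nat.card_zmod, hcard] at htotal
  omega

/-- in any planar realization of the double ring convex geometry
(D_{2k}, C_{2k}), for each i, each open half-plane bounded by the line through
the images of r_i and r'_i contains exactly k−1 of the pairs {r_j, r'_j}, and
the points strictly on one side together with r_i form one of the two maximal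
convexly closed sets containing r_i but not r'_i. -/
theorem doubleRing_realization_halfplanes (k : ℕ) (hk : 2 ≤ k) (R ε : ℝ)
    (hR : 0 < R) (hε : 0 < ε) (hεR : ε < R)
    (r r' : ZMod (2 * k) → ℝ × ℝ)
    (hr : ∀ j : ZMod (2 * k),
      r j = (R * Real.cos (2 * Real.pi * (j.val : ℝ) / (2 * k)),
             R * Real.sin (2 * Real.pi * (j.val : ℝ) / (2 * k))))
    (hr' : ∀ j : ZMod (2 * k),
      r' j = ((R - ε) * Real.cos (2 * Real.pi * (j.val : ℝ) / (2 * k)),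
              (R - ε) * Real.sin (2 * Real.pi * (j.val : ℝ) / (2 * k))))
    (hvertex : ∀ j : ZMod (2 * k),
      r' j ∉ convexHull ℝ ((Set.range r ∪ Set.range r') \ {r j, r' j}))
    -- a realization: a point set P with a bijection f from D_{2k} to P
    -- inducing an isomorphism of the families of convexly closed sets
    (P : Set (ℝ × ℝ)) (f : (ℝ × ℝ) → (ℝ × ℝ))
    (hf : Set.BijOn f (Set.range r ∪ Set.range r') P)
    (hiso : ∀ C ⊆ Set.range r ∪ Set.range r',
      (convexHull ℝ C ∩ (Set.range r ∪ Set.range r') = C ↔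
        convexHull ℝ (f '' C) ∩ P = f '' C))
    (i : ZMod (2 * k)) :
    ∀ s ∈ ({-1, 1} : Set ℝ),
      {j : ZMod (2 * k) | orient (f (r i)) (f (r' i)) (f (r j)) = s ∧
        orient (f (r i)) (f (r' i)) (f (r' j)) = s}.ncard = k - 1 ∧
      (let C : Set (ℝ × ℝ) :=
        {f (r i)} ∪ {x ∈ P | orient (f (r i)) (f (r' i)) x = s}
       convexHull ℝ C ∩ P = C ∧ f (r i) ∈ C ∧ f (r' i) ∉ C ∧
        ∀ C' : Set (ℝ × ℝ), C ⊆ C' → C' ⊆ P → convexHull ℝ C' ∩ P = C' →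
          f (r' i) ∉ C' → C' = C) := by
  set D := Set.range r ∪ Set.range r' with hD
  set c := Real.cos (spokeAngle k i) with hc
  set t := Real.sin (spokeAngle k i) with ht
  have hct : c ^ 2 + t ^ 2 = 1 := Real.cos_sq_add_sin_sq _
  have hri : r i = (R * c, R * t) := hr i
  have hri' : r' i = ((R - ε) * c, (R - ε) * t) := hr' i
  have hδ : 0 < R - ε := sub_pos.2 hεR
  set g : ℝ × ℝ →ₗ[ℝ] ℝ := c • LinearMap.snd ℝ ℝ ℝ - t • LinearMap.fst ℝ ℝ ℝ with hg
  have g_apply : ∀ x, g x = c * x.2 - t * x.1 := fun x => by simp [hg]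
  have g_r : ∀ j, g (r j) = R * Real.sin (spokeAngle k j - spokeAngle k i) := by
    intro j
    rw [g_apply, hr j, Real.sin_sub, ← hc, ← ht]
    simp only [spokeAngle]
    ring
  have g_r' : ∀ j, g (r' j) = (R - ε) * Real.sin (spokeAngle k j - spokeAngle k i) := by
    intro j
    rw [g_apply, hr' j, Real.sin_sub, ← hc, ← ht]
    simp only [spokeAngle]
    ring
  have hgp : g (r i) = 0 := by simp [g_r]
  have hgq : g (r' i) = 0 := by simp [g_r']
  have hpD : ∀ j, r j ∈ D := fun j => Or.inl ⟨j, rfl⟩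
  have hqD : ∀ j, r' j ∈ D := fun j => Or.inr ⟨j, rfl⟩
  have hopp : ∀ j, r (j + k) = -r j := by
    intro j
    have h1 := cos_spokeAngle_add_half hk j
    have h2 := sin_spokeAngle_add_half hk j
    rw [hr, hr]
    unfold spokeAngle at h1 h2
    rw [h1, h2]
    simp
  have hopp' : ∀ j, r' (j + k) = -r' j := by
    intro j
    have h1 := cos_spokeAngle_add_half hk j
    have h2 := sin_spokeAngle_add_half hk j
    rw [hr', hr']
    unfold spokeAngle at h1 h2
    rw [h1, h2]
    simp
  have hpq : r i ≠ r' i := by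
    intro h
    rw [hri, hri', Prod.mk.injEq] at h
    have h1 : ε * c = 0 := by linarith [h.1]
    have h2 : ε * t = 0 := by linarith [h.2]
    have h3 := (mul_eq_zero.1 h1).resolve_left hε.ne'
    have h4 := (mul_eq_zero.1 h2).resolve_left hε.ne'
    rw [h3, h4] at hct
    norm_num at hct
  obtain ⟨hcardpos, hcardneg⟩ := ncard_sin_spokeAngle_pos_and_neg hk i
  obtain ⟨j₁, hj₁⟩ := Set.nonempty_of_ncard_ne_zero (by rw [hcardpos]; omega)
  obtain ⟨j₂, hj₂⟩ := Set.nonempty_of_ncard_ne_zero (by rw [hcardneg]; omega)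
  have hga : 0 < g (r j₁) := by rw [g_r]; exact mul_pos hR hj₁
  have hgb : g (r j₂) < 0 := by rw [g_r]; exact mul_neg_of_pos_of_neg hR hj₂
  have off : ∀ x ∈ D, g x ≠ 0 → x ∈ D \ {r i, r' i} := by
    refine fun x hx hgx => ⟨hx, ?_⟩
    rintro (rfl | rfl)
    · exact hgx hgp
    · exact hgx hgq
  have behind : ∀ u, u < R - ε → r' i ∈ segment ℝ (r i) (u * c, u * t) := by
    intro u hu
    have h0 : 0 < R - u := by linarith
    refine ⟨(R - ε - u) / (R - u), ε / (R - u), by apply div_nonneg <;> linarith, by positivity,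
      by field_simp; ring, ?_⟩
    rw [hri, hri']
    ext <;> simp <;> field_simp <;> ring
  have hzero : ∀ x ∈ D, g x = 0 → x = r i ∨ r' i ∈ convexHull ℝ {r i, x} := by
    rw [hD]
    rintro x (⟨j, rfl⟩ | ⟨j, rfl⟩) hgx
    · rw [g_r, mul_eq_zero, or_iff_right hR.ne', sin_spokeAngle_sub_eq_zero_iff hk] at hgx
      rcases hgx with rfl | rfl
      · exact Or.inl rfl
      · right
        rw [convexHull_pair]
        have h := behind (-R) (by linarith)
        rwa [hopp, show -r i = (-R * c, -R * t) by rw [hri]; simp]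
    · right
      rw [g_r', mul_eq_zero, or_iff_right hδ.ne', sin_spokeAngle_sub_eq_zero_iff hk] at hgx
      rw [convexHull_pair]
      rcases hgx with rfl | rfl
      · exact right_mem_segment ℝ _ _
      · have h := behind (-(R - ε)) (by linarith)
        rwa [hopp', show -r' i = (-(R - ε) * c, -(R - ε) * t) by
          rw [hri']; simp only [neg_mul, Prod.neg_mk]]
  have hcenter : (0 : ℝ × ℝ) ∈ convexHull ℝ (D \ {r i, r' i}) := by
    have h1 := subset_convexHull ℝ _ (off _ (hpD j₁) hga.ne')
    have h2 : -r j₁ ∈ convexHull ℝ (D \ {r i, r' i}) := by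
      rw [← hopp]
      refine subset_convexHull ℝ _ (off _ (hpD _) ?_)
      rw [hopp, map_neg]
      exact neg_ne_zero.2 hga.ne'
    have h3 := convex_convexHull ℝ (D \ {r i, r' i}) h1 h2 (a := 1 / 2) (b := 1 / 2)
      (by norm_num) (by norm_num) (by norm_num)
    simpa using h3
  have hcross : ∀ x ∈ D, ∀ y ∈ D, 0 < g x → g y < 0 →
      r' i ∈ convexHull ℝ {r i, x, y} := by
    intro x hx y hy hgx hgy
    have hxy : 0 < g x - g y := by linarith
    obtain ⟨a, b, ha, hb, hab, hgz⟩ : ∃ a b : ℝ, 0 ≤ a ∧ 0 ≤ b ∧ a + b = 1 ∧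
        g (a • x + b • y) = 0 := by
      refine ⟨-g y / (g x - g y), g x / (g x - g y), by apply div_nonneg <;> linarith,
        by positivity, by field_simp; ring, ?_⟩
      simp only [map_add, map_smul, smul_eq_mul]
      field_simp
      ring
    have hz : ∀ S : Set (ℝ × ℝ), x ∈ S → y ∈ S → a • x + b • y ∈ convexHull ℝ S :=
      fun S h1 h2 => convex_convexHull ℝ S (subset_convexHull ℝ S h1) (subset_convexHull ℝ S h2)
        ha hb hab
    set z := a • x + b • y
    obtain ⟨u, hu⟩ : ∃ u : ℝ, z = (u * c, u * t) := by
      rw [g_apply] at hgz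
      refine ⟨z.1 * c + z.2 * t, Prod.ext ?_ ?_⟩
      · simp only
        linear_combination -z.1 * hct - t * hgz
      · simp only
        linear_combination -z.2 * hct + c * hgz
    have hlt : u < R - ε := by
      by_contra hcon
      have hu0 : 0 < u := by linarith
      apply hvertex i
      have h := convex_convexHull ℝ (D \ {r i, r' i})
        (hz _ (off x hx hgx.ne') (off y hy hgy.ne)) hcenter
        (a := (R - ε) / u) (b := 1 - (R - ε) / u) (by positivity)
        (by rw [sub_nonneg, div_le_one hu0]; linarith) (by ring)
      convert h using 1
      rw [hu, hri']
      ext <;> simp <;> field_simp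
    have h := behind u hlt
    rw [← hu] at h
    exact (convex_convexHull ℝ _).segment_subset (subset_convexHull ℝ _ (by simp))
      (hz _ (by simp) (by simp)) h
  obtain ⟨τ, hτ, horient⟩ := exists_orient_eq_mul_sign hf hiso (hpD i) (hqD i) hpq g hgp hgq
    hzero hcross (hpD j₁) (hpD j₂) hga hgb
  have transfer : ∀ S ⊆ D, r' i ∈ convexHull ℝ S → f (r' i) ∈ convexHull ℝ (f '' S) :=
    fun S hS => (mem_convexHull_image_iff hf hiso hS (hqD i)).2
  intro s hs
  have hs' : s = -1 ∨ s = 1 := hs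
  have hτs : (τ * s = 1 ∨ τ * s = -1) ∧ ∀ a, τ * a = s ↔ a = τ * s := by
    rcases hτ with rfl | rfl <;> rcases hs' with rfl | rfl <;>
      refine ⟨by norm_num, fun a => ⟨fun h => by linarith, fun h => by linarith⟩⟩
  obtain ⟨hσ, hτs⟩ := hτs
  refine ⟨?_, halfplane_isMaximal_closed (hf.mapsTo (hpD i)) (hf.mapsTo (hqD i))
    (fun h => hpq (hf.injOn (hpD i) (hqD i) h)) hs' ?_⟩
  · simp only [horient _ (hpD _), horient _ (hqD _), g_r, g_r', real_sign_mul_of_pos hR,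
      real_sign_mul_of_pos hδ, and_self, hτs]
    rcases hσ with hσ | hσ <;> rw [hσ]
    · simpa only [real_sign_eq_one_iff] using hcardpos
    · simpa only [real_sign_eq_neg_one_iff] using hcardneg
  · intro x hxP hxp hxs
    obtain ⟨y, hy, rfl⟩ := hf.surjOn hxP
    rw [horient y hy, Ne, hτs] at hxs
    have good : ∀ w ∈ D, Real.sign (g w) = τ * s → f w ∈ ({f y} ∪ ({f (r i)} ∪
        {v ∈ P | orient (f (r i)) (f (r' i)) v = s}) : Set (ℝ × ℝ)) := fun w hw h =>
      Or.inr (Or.inr ⟨hf.mapsTo hw, by rw [horient w hw, hτs]; exact h⟩)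
    by_cases hgy : g y = 0
    · have h := (hzero y hy hgy).resolve_left (fun h => hxp (by rw [h]))
      refine convexHull_mono ?_ (transfer {r i, y} ?_ h)
      · rintro _ ⟨w, rfl | rfl, rfl⟩ <;> simp
      · rintro w (rfl | rfl)
        exacts [hpD i, hy]
    · obtain ⟨w, hw, hws, h⟩ : ∃ w ∈ D, Real.sign (g w) = τ * s ∧
          r' i ∈ convexHull ℝ {r i, w, y} := by
        rcases hσ with hσ | hσ <;> rw [hσ] at hxs ⊢
        · rw [real_sign_eq_one_iff] at hxs
          exact ⟨r j₁, hpD _, real_sign_eq_one_iff.2 hga, hcross _ (hpD _) _ hy hga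
            (lt_of_le_of_ne (not_lt.1 hxs) hgy)⟩
        · rw [real_sign_eq_neg_one_iff] at hxs
          refine ⟨r j₂, hpD _, real_sign_eq_neg_one_iff.2 hgb, ?_⟩
          rw [Set.pair_comm]
          exact hcross _ hy _ (hpD _) (lt_of_le_of_ne (not_lt.1 hxs) (Ne.symm hgy)) hgb
      refine convexHull_mono ?_ (transfer {r i, w, y} ?_ h)
      · rintro _ ⟨v, rfl | rfl | rfl, rfl⟩
        · simp
        · exact good _ hw hws
        · simp
      · rintro v (rfl | rfl | rfl)
        exacts [hpD i, hw, hy]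
end

section
/- In any planar realization of the double ring convex geometry (D_{2k}, C_{2k}), the cyclic order of the convex-hull vertices r_1, …, r_{2k} agrees, up to reflection and rotation, with the order (r_1, r_2, …, r_{2k}). -/
section

open Set

/-- A point of a segment cuts it into two segments covering it. -/
lemma mem_segment_left_or_right {E : Type*} [AddCommGroup E] [Module ℝ E] {a b x y : E}
    (hx : x ∈ segment ℝ a b) (hy : y ∈ segment ℝ a b) :
    x ∈ segment ℝ a y ∨ x ∈ segment ℝ y b := by
  rw [segment_eq_image_lineMap] at hx hy
  obtain ⟨s, hs, rfl⟩ := hx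
  obtain ⟨t, ht, rfl⟩ := hy
  simp only [mem_segment_iff_wbtw]
  rcases le_total s t with h | h
  · left
    have : Wbtw ℝ 0 s t := by
      rw [← mem_segment_iff_wbtw, segment_eq_Icc (hs.1.trans h)]; exact ⟨hs.1, h⟩
    simpa using this.map (AffineMap.lineMap a b)
  · right
    have : Wbtw ℝ t s 1 := by
      rw [← mem_segment_iff_wbtw, segment_eq_Icc (h.trans hs.2)]; exact ⟨h, hs.2⟩
    simpa using this.map (AffineMap.lineMap a b)

/-- Among three points on a line, one lies between the other two. -/
lemma mem_segment_of_eq_lineMap {E : Type*} [AddCommGroup E] [Module ℝ E] {a b x : E} {t : ℝ}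
    (hx : x = AffineMap.lineMap a b t) :
    x ∈ segment ℝ a b ∨ a ∈ segment ℝ x b ∨ b ∈ segment ℝ x a := by
  have hc : Collinear ℝ {x, a, b} :=
    collinear_insert_of_mem_affineSpan_pair (hx ▸ AffineMap.lineMap_mem_affineSpan_pair t a b)
  simp only [mem_segment_iff_wbtw]
  rcases hc.wbtw_or_wbtw_or_wbtw with h | h | h
  · exact Or.inr (Or.inl h)
  · exact Or.inr (Or.inr h.symm)
  · exact Or.inl h.symm

/-- A line in the plane avoiding `p` is a level set of a linear form smaller at `p`. -/
lemma exists_linear_form_lt {a b p : ℝ × ℝ} (hab : a ≠ b)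
    (hp : ∀ t : ℝ, p ≠ AffineMap.lineMap a b t) :
    ∃ g : (ℝ × ℝ) →ₗ[ℝ] ℝ, g b = g a ∧ g p < g a ∧
      ∀ x, g x = g a → ∃ t : ℝ, x = AffineMap.lineMap a b t := by
  let g : (ℝ × ℝ) →ₗ[ℝ] ℝ :=
    (b.1 - a.1) • LinearMap.snd ℝ ℝ ℝ - (b.2 - a.2) • LinearMap.fst ℝ ℝ ℝ
  have hg : ∀ x, g x = (b.1 - a.1) * x.2 - (b.2 - a.2) * x.1 := fun x => by simp [g]
  have hline : ∀ x, g x = g a → ∃ t : ℝ, x = AffineMap.lineMap a b t := by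
    intro x hx
    rw [hg, hg] at hx
    by_cases h1 : b.1 - a.1 = 0
    · have h2 : b.2 - a.2 ≠ 0 := fun h2 =>
        hab (Prod.ext (sub_eq_zero.1 h1).symm (sub_eq_zero.1 h2).symm)
      refine ⟨(x.2 - a.2) / (b.2 - a.2), Prod.ext ?_ ?_⟩ <;>
        simp only [AffineMap.lineMap_apply, vsub_eq_sub,
          vadd_eq_add, Prod.fst_add, Prod.snd_add, Prod.smul_fst, Prod.smul_snd, Prod.fst_sub,
          Prod.snd_sub, smul_eq_mul]
      · field_simp; linear_combination -hx
      · field_simp; ring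
    · refine ⟨(x.1 - a.1) / (b.1 - a.1), Prod.ext ?_ ?_⟩ <;>
        simp only [AffineMap.lineMap_apply, vsub_eq_sub,
          vadd_eq_add, Prod.fst_add, Prod.snd_add, Prod.smul_fst, Prod.smul_snd, Prod.fst_sub,
          Prod.snd_sub, smul_eq_mul]
      · field_simp; ring
      · field_simp; linear_combination hx
  have hb : g b = g a := by rw [hg, hg]; ring
  have hne : g p ≠ g a := fun h => (hline p h).elim hp
  rcases lt_or_gt_of_ne hne with h | h
  · exact ⟨g, hb, h, hline⟩
  · exact ⟨-g, by simpa using hb, by simpa using h, fun x hx => hline x (by simpa using hx)⟩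

/-- If the diagonals `Q j Q (j + k)` of a set of points in convex position pairwise cross, as
witnessed by the points `Q' j` on them, and no diagonal separates `Q i` from `Q (i + 1)`, then
`Q i` and `Q (i + 1)` span an edge of the convex hull. -/
lemma supporting_line_of_crossing_diagonals {k : ℕ} (hk : 2 ≤ k)
    (Q Q' : ZMod (2 * k) → ℝ × ℝ) (i : ZMod (2 * k))
    (hinj : Function.Injective Q) (hne : ∀ j m, Q' j ≠ Q m)
    (hext : ∀ j, ∀ S ⊆ range Q, Q j ∉ S → Q j ∉ convexHull ℝ S)
    (hseg : ∀ j, Q' j ∈ segment ℝ (Q j) (Q (j + k)))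
    (hcross : ∀ a, Q' i ∈ convexHull ℝ {Q i, Q a, Q (a + k)})
    (hside : ∀ j, j ≠ i → j ≠ i + 1 → j + k ≠ i → j + k ≠ i + 1 →
      Q' j ∉ convexHull ℝ {Q j, Q i, Q (i + 1)})
    (hfar : ∀ j, j ≠ i → j ≠ i + 1 → j + k ≠ i → j + k ≠ i + 1 →
      Q' j ∉ convexHull ℝ {Q (j + k), Q i, Q (i + 1)}) :
    ∃ g : (ℝ × ℝ) →ₗ[ℝ] ℝ, ∃ c : ℝ, g ≠ 0 ∧ g (Q i) = c ∧ g (Q (i + 1)) = c ∧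
      ∀ x ∈ range Q ∪ range Q', x ≠ Q i → x ≠ Q (i + 1) → g x < c := by
  have hkk : (k : ZMod (2 * k)) + k = 0 := by
    rw [← Nat.cast_add, ← two_mul, ZMod.natCast_self]
  have hcast : ∀ n : ℕ, 0 < n → n < 2 * k → (n : ZMod (2 * k)) ≠ 0 := fun n h0 hn h =>
    absurd (Nat.le_of_dvd h0 ((ZMod.natCast_eq_zero_iff _ _).1 h)) (by omega)
  have hone : (1 : ZMod (2 * k)) ≠ 0 := by simpa using hcast 1 (by omega) (by omega)
  have hk0 : (k : ZMod (2 * k)) ≠ 0 := hcast k (by omega) (by omega)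
  have hk1 : (k : ZMod (2 * k)) + 1 ≠ 0 := by simpa using hcast (k + 1) (by omega) (by omega)
  have hk1' : (k : ZMod (2 * k)) ≠ 1 := fun h => hk1 (by rw [← h, hkk])
  -- three outer points are never collinear
  have htri : ∀ a b c, a ≠ b → a ≠ c → Q a ∉ segment ℝ (Q b) (Q c) := by
    intro a b c hab hac h
    rw [← convexHull_pair] at h
    refine hext a _ ?_ ?_ h
    · rintro _ (rfl | rfl) <;> exact mem_range_self _
    · simp [hinj.eq_iff, hab, hac]
  have hncol : ∀ m, m ≠ i → m ≠ i + 1 → ∀ t : ℝ, Q m ≠ AffineMap.lineMap (Q i) (Q (i + 1)) t := by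
    intro m h1 h2 t ht
    have h3 : i ≠ i + 1 := by simpa using hone
    rcases mem_segment_of_eq_lineMap ht with h | h | h
    · exact htri _ _ _ h1 h2 h
    · exact htri _ _ _ h1.symm h3 h
    · exact htri _ _ _ h2.symm h3.symm h
  obtain ⟨g, hg1, hgk, hgl⟩ := exists_linear_form_lt (a := Q i) (b := Q (i + 1)) (p := Q (i + k))
    (fun h => hone (by simpa using hinj h))
    (hncol _ (by simpa using hk0) (by simpa using hk1'))
  have hopen : ∀ j, ∃ a b : ℝ, 0 < a ∧ 0 < b ∧ a + b = 1 ∧ Q' j = a • Q j + b • Q (j + k) := by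
    intro j
    have := mem_openSegment_of_ne_left_right (hne j j).symm (hne j (j + k)).symm (hseg j)
    obtain ⟨a, b, ha, hb, hab, h⟩ := this
    exact ⟨a, b, ha, hb, hab, h.symm⟩
  have hgi : g (Q' i) < g (Q i) := by
    obtain ⟨a, b, ha, hb, hab, h⟩ := hopen i
    rw [h, map_add, map_smul, map_smul, smul_eq_mul, smul_eq_mul]
    obtain rfl : a = 1 - b := by linarith
    nlinarith
  have hor : ∀ a, g (Q a) < g (Q i) ∨ g (Q (a + k)) < g (Q i) := by
    intro a
    by_contra! h
    have hsub : convexHull ℝ {Q i, Q a, Q (a + k)} ⊆ {x | g (Q i) ≤ g x} := by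
      refine convexHull_min ?_ (convex_halfSpace_ge g.isLinear _)
      rintro _ (rfl | rfl | rfl)
      exacts [le_refl (g (Q i)), h.1, h.2]
    exact absurd (hsub (hcross a)) (not_le.2 hgi)
  have hQ : ∀ m, m ≠ i → m ≠ i + 1 → g (Q m) < g (Q i) := by
    intro j h1 h2
    by_cases h3 : j + k = i
    · have : j = i + k := by rw [← h3, add_assoc, hkk, add_zero]
      rwa [this]
    by_cases h4 : j + k = i + 1
    · exact (hor j).resolve_right (by rw [h4, hg1]; exact lt_irrefl _)
    by_contra hlt
    have hgt : g (Q i) < g (Q j) := lt_of_le_of_ne (not_lt.1 hlt)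
      fun h => (hgl _ h.symm).elim (hncol j h1 h2)
    have hlt' := (hor j).resolve_left hlt
    obtain ⟨Y, hY, hgY⟩ : ∃ Y ∈ segment ℝ (Q j) (Q (j + k)), g Y = g (Q i) := by
      have hd : 0 < g (Q j) - g (Q (j + k)) := by linarith
      refine ⟨_, ⟨(g (Q i) - g (Q (j + k))) / (g (Q j) - g (Q (j + k))),
        (g (Q j) - g (Q i)) / (g (Q j) - g (Q (j + k))), div_nonneg (by linarith) hd.le,
        div_nonneg (by linarith) hd.le, by field_simp; ring, rfl⟩, ?_⟩
      rw [map_add, map_smul, map_smul, smul_eq_mul, smul_eq_mul]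
      field_simp
      ring
    obtain ⟨t, ht⟩ := hgl Y hgY
    have hsubhull : ∀ {S : Set (ℝ × ℝ)} {x y z : ℝ × ℝ}, x ∈ segment ℝ y z →
        y ∈ convexHull ℝ S → z ∈ convexHull ℝ S → x ∈ convexHull ℝ S :=
      fun hx hy hz => (convex_convexHull ℝ _).segment_subset hy hz hx
    have hmem : ∀ {S : Set (ℝ × ℝ)} {x}, x ∈ S → x ∈ convexHull ℝ S :=
      fun h => subset_convexHull ℝ _ h
    have h5 : i ≠ i + 1 := by simpa using hone
    rcases mem_segment_of_eq_lineMap ht with h | h | h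
    · rcases mem_segment_left_or_right (hseg j) hY with h' | h'
      · exact hside j h1 h2 h3 h4 (hsubhull h' (hmem (by simp))
          (hsubhull h (hmem (by simp)) (hmem (by simp))))
      · exact hfar j h1 h2 h3 h4 (hsubhull h' (hsubhull h (hmem (by simp)) (hmem (by simp)))
          (hmem (by simp)))
    · refine hext i {Q j, Q (j + k), Q (i + 1)} ?_ ?_ (hsubhull h
        (hsubhull hY (hmem (by simp)) (hmem (by simp))) (hmem (by simp)))
      · rintro _ (rfl | rfl | rfl) <;> exact mem_range_self _
      · simp only [mem_insert_iff, mem_singleton_iff, hinj.eq_iff]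
        rintro (h | h | h)
        exacts [h1 h.symm, h3 h.symm, h5 h]
    · refine hext (i + 1) {Q j, Q (j + k), Q i} ?_ ?_ (hsubhull h
        (hsubhull hY (hmem (by simp)) (hmem (by simp))) (hmem (by simp)))
      · rintro _ (rfl | rfl | rfl) <;> exact mem_range_self _
      · simp only [mem_insert_iff, mem_singleton_iff, hinj.eq_iff]
        rintro (h | h | h)
        exacts [h2 h.symm, h4 h.symm, h5 h.symm]
  have hQle : ∀ m, g (Q m) ≤ g (Q i) := by
    intro m
    by_cases h1 : m = i
    · rw [h1]
    by_cases h2 : m = i + 1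
    · rw [h2, hg1]
    exact (hQ m h1 h2).le
  refine ⟨g, g (Q i), fun h => by simp [h] at hgk, rfl, hg1, ?_⟩
  rintro _ (⟨m, rfl⟩ | ⟨m, rfl⟩) h1 h2
  · exact hQ m (fun h => h1 (by rw [h])) (fun h => h2 (by rw [h]))
  · obtain ⟨a, b, ha, hb, hab, h⟩ := hopen m
    rw [h, map_add, map_smul, map_smul, smul_eq_mul, smul_eq_mul]
    have := hQle m
    have := hQle (m + k)
    obtain rfl : a = 1 - b := by linarith
    rcases hor m with h | h <;> nlinarith

/-- A bijection matching the closed sets of two induced convex geometries matches membership in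
convex hulls. -/
lemma mem_convexHull_image_iff_s13 {E F : Type*} [AddCommGroup E] [Module ℝ E] [AddCommGroup F]
    [Module ℝ F] {D : Set E} {P : Set F} {f : E → F} (hf : BijOn f D P)
    (hiso : ∀ C ⊆ D, (convexHull ℝ C ∩ D = C ↔ convexHull ℝ (f '' C) ∩ P = f '' C))
    {S : Set E} (hS : S ⊆ D) {p : E} (hp : p ∈ D) :
    f p ∈ convexHull ℝ (f '' S) ↔ p ∈ convexHull ℝ S := by
  constructor
  · intro h
    have hcl : convexHull ℝ (convexHull ℝ S ∩ D) ∩ D = convexHull ℝ S ∩ D := by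
      refine Subset.antisymm (fun x hx => ⟨?_, hx.2⟩)
        (fun x hx => ⟨subset_convexHull ℝ _ hx, hx.2⟩)
      exact convexHull_min inter_subset_left (convex_convexHull ℝ S) hx.1
    have hcl' := (hiso _ inter_subset_right).1 hcl
    have hmem : f p ∈ f '' (convexHull ℝ S ∩ D) := by
      rw [← hcl']
      exact ⟨convexHull_mono (image_mono (subset_inter (subset_convexHull ℝ S) hS)) h,
        hf.mapsTo hp⟩
    obtain ⟨q, hq, hqp⟩ := hmem
    rw [← hf.injOn hq.2 hp hqp]
    exact hq.1
  · intro h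
    set C : Set E := {x ∈ D | f x ∈ convexHull ℝ (f '' S)}
    have himg : f '' C = convexHull ℝ (f '' S) ∩ P := by
      ext y
      constructor
      · rintro ⟨x, hx, rfl⟩
        exact ⟨hx.2, hf.mapsTo hx.1⟩
      · rintro ⟨hy, hyP⟩
        obtain ⟨x, hx, rfl⟩ := hf.surjOn hyP
        exact ⟨x, ⟨hx, hy⟩, rfl⟩
    have hcl : convexHull ℝ (f '' C) ∩ P = f '' C := by
      rw [himg]
      refine Subset.antisymm (fun x hx => ⟨?_, hx.2⟩)
        (fun x hx => ⟨subset_convexHull ℝ _ hx, hx.2⟩)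
      exact convexHull_min inter_subset_left (convex_convexHull ℝ _) hx.1
    have hcl' := (hiso C (sep_subset _ _)).2 hcl
    have hSC : S ⊆ C := fun x hx => ⟨hS hx, subset_convexHull ℝ _ (mem_image_of_mem f hx)⟩
    have : p ∈ C := hcl' ▸ ⟨convexHull_mono hSC h, hp⟩
    exact this.2

/-- `ZMod.stdAddChar` takes the value `-1` at the element of order two. -/
lemma stdAddChar_half {k : ℕ} [NeZero (2 * k)] :
    ZMod.stdAddChar (k : ZMod (2 * k)) = -1 := by
  have hk : (k : ℂ) ≠ 0 := by
    have := NeZero.ne (2 * k)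
    exact_mod_cast fun h : k = 0 => this (by simp [h])
  rw [ZMod.stdAddChar_apply, ZMod.toCircle_natCast, ← Complex.exp_pi_mul_I]
  congr 1
  push_cast
  field_simp

lemma stdAddChar_re {N : ℕ} [NeZero N] (j : ZMod N) :
    (ZMod.stdAddChar j).re = Real.cos (2 * Real.pi * (j.val : ℝ) / N) := by
  rw [ZMod.stdAddChar_apply, ZMod.toCircle_apply, ← Complex.exp_ofReal_mul_I_re]
  congr 2
  push_cast
  ring

lemma stdAddChar_im {N : ℕ} [NeZero N] (j : ZMod N) :
    (ZMod.stdAddChar j).im = Real.sin (2 * Real.pi * (j.val : ℝ) / N) := by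
  rw [ZMod.stdAddChar_apply, ZMod.toCircle_apply, ← Complex.exp_ofReal_mul_I_im]
  congr 2
  push_cast
  ring

/-- Consecutive roots of unity, neither of them real, lie on the same side of the real axis. -/
lemma stdAddChar_im_mul_im_succ_pos {k : ℕ} (hk : 2 ≤ k) [NeZero (2 * k)] {m : ZMod (2 * k)}
    (h0 : m ≠ 0) (hmk : m ≠ k) (h1 : m + 1 ≠ 0) (h1k : m + 1 ≠ k) :
    0 < (ZMod.stdAddChar m).im * (ZMod.stdAddChar (m + 1)).im := by
  have hlt := m.val_lt
  have hcast : ((m.val : ℕ) : ZMod (2 * k)) = m := ZMod.natCast_zmod_val m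
  have hn0 : m.val ≠ 0 := fun h => h0 (by rw [← hcast, h, Nat.cast_zero])
  have hnk : m.val ≠ k := fun h => hmk (by rw [← hcast, h])
  have hn1 : m.val + 1 ≠ 2 * k := fun h => h1 (by
    rw [← hcast, ← Nat.cast_succ, Nat.succ_eq_add_one, h, ZMod.natCast_self])
  have hn1k : m.val + 1 ≠ k := fun h => h1k (by
    rw [← hcast, ← Nat.cast_succ, Nat.succ_eq_add_one, h])
  have hsucc : (m + 1).val = m.val + 1 := by
    rw [ZMod.val_add_of_lt, ZMod.val_one'' (by omega)]
    rw [ZMod.val_one'' (by omega)]; omega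
  rw [stdAddChar_im, stdAddChar_im, hsucc]
  have hkpos : (0 : ℝ) < k := by exact_mod_cast (by omega : 0 < k)
  have hang : ∀ n : ℕ, 2 * Real.pi * (n : ℝ) / ((2 * k : ℕ) : ℝ) = Real.pi * (n / k) := by
    intro n; push_cast; field_simp
  rw [hang, hang]
  have hpos : ∀ n : ℕ, 0 < n → n < k → 0 < Real.sin (Real.pi * (n / k)) := by
    intro n hn hnk
    have hn' : (0 : ℝ) < n := by exact_mod_cast hn
    have hnk' : (n : ℝ) / k < 1 := (div_lt_one hkpos).2 (by exact_mod_cast hnk)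
    exact Real.sin_pos_of_pos_of_lt_pi (by positivity)
      (mul_lt_of_lt_one_right Real.pi_pos hnk')
  have hneg : ∀ n : ℕ, k < n → n < 2 * k → Real.sin (Real.pi * (n / k)) < 0 := by
    intro n hn hnk
    have h := hpos (n - k) (by omega) (by omega)
    rw [Nat.cast_sub hn.le, sub_div, div_self hkpos.ne', mul_sub, mul_one,
      Real.sin_sub_pi] at h
    linarith
  rcases lt_or_gt_of_ne hnk with h | h
  · exact mul_pos (hpos _ (by omega) h) (hpos _ (by omega) (by omega))
  · exact mul_pos_of_neg_of_neg (hneg _ h hlt) (hneg _ (by omega) (by omega))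

end

/-- in any planar realization of the double ring convex geometry
(D_{2k}, C_{2k}), the cyclic order of the convex-hull vertices agrees with
(r_1, …, r_{2k}) up to rotation and reflection; equivalently, for every i the
images of the consecutive outer points r_i and r_{i+1} are adjacent vertices of
the convex hull of the realization, witnessed by a supporting line. -/
theorem doubleRing_realization_cyclic_order (k : ℕ) (hk : 2 ≤ k) (R ε : ℝ)
    (hR : 0 < R) (hε : 0 < ε) (hεR : ε < R)
    (r r' : ZMod (2 * k) → ℝ × ℝ)
    (hr : ∀ j : ZMod (2 * k),
      r j = (R * Real.cos (2 * Real.pi * (j.val : ℝ) / (2 * k)),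
             R * Real.sin (2 * Real.pi * (j.val : ℝ) / (2 * k))))
    (hr' : ∀ j : ZMod (2 * k),
      r' j = ((R - ε) * Real.cos (2 * Real.pi * (j.val : ℝ) / (2 * k)),
              (R - ε) * Real.sin (2 * Real.pi * (j.val : ℝ) / (2 * k))))
    (hvertex : ∀ j : ZMod (2 * k),
      r' j ∉ convexHull ℝ ((Set.range r ∪ Set.range r') \ {r j, r' j}))
    -- a realization: a point set P with a bijection f from D_{2k} to P
    -- inducing an isomorphism of the families of convexly closed sets
    (P : Set (ℝ × ℝ)) (f : (ℝ × ℝ) → (ℝ × ℝ))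
    (hf : Set.BijOn f (Set.range r ∪ Set.range r') P)
    (hiso : ∀ C ⊆ Set.range r ∪ Set.range r',
      (convexHull ℝ C ∩ (Set.range r ∪ Set.range r') = C ↔
        convexHull ℝ (f '' C) ∩ P = f '' C)) :
    ∀ i : ZMod (2 * k), ∃ g : (ℝ × ℝ) →ₗ[ℝ] ℝ, ∃ c : ℝ, g ≠ 0 ∧
      g (f (r i)) = c ∧ g (f (r (i + 1))) = c ∧
      ∀ x ∈ P, x ≠ f (r i) → x ≠ f (r (i + 1)) → g x < c := by
  intro i
  have : NeZero (2 * k) := ⟨by omega⟩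
  set u : AddChar (ZMod (2 * k)) ℂ := ZMod.stdAddChar with hu
  replace hr : ∀ j, r j = (R * (u j).re, R * (u j).im) := fun j => by
    rw [hr, hu, stdAddChar_re, stdAddChar_im]; push_cast; rfl
  replace hr' : ∀ j, r' j = ((R - ε) * (u j).re, (R - ε) * (u j).im) := fun j => by
    rw [hr', hu, stdAddChar_re, stdAddChar_im]; push_cast; rfl
  have hsq : ∀ j, (u j).re ^ 2 + (u j).im ^ 2 = 1 := fun j => by
    rw [hu, stdAddChar_re, stdAddChar_im, Real.cos_sq_add_sin_sq]
  have huinj : Function.Injective u := ZMod.injective_stdAddChar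
  have hanti : ∀ j, u (j + k) = -u j := fun j => by
    rw [AddChar.map_add_eq_mul, hu, stdAddChar_half, mul_neg_one]
  have hrk : ∀ j, r (j + k) = -r j := fun j => by
    rw [hr, hr, hanti]; ext <;> simp
  have hr'r : ∀ j, r' j = (1 - ε / R) • r j := fun j => by
    rw [hr, hr']; ext <;> simp <;> field_simp
  have hεR0 : 0 < ε / R := div_pos hε hR
  have hεR1 : ε / R < 1 := (div_lt_one hR).2 hεR
  have hrinj : Function.Injective r := fun a b h => by
    rw [hr, hr, Prod.mk.injEq] at h
    exact huinj (Complex.ext (mul_left_cancel₀ hR.ne' h.1) (mul_left_cancel₀ hR.ne' h.2))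
  have hr'ne : ∀ j m, r' j ≠ r m := fun j m h => by
    rw [hr, hr', Prod.mk.injEq] at h
    have h1 : (R - ε) ^ 2 = R ^ 2 := by
      linear_combination ((R - ε) * (u j).re + R * (u m).re) * h.1 +
        ((R - ε) * (u j).im + R * (u m).im) * h.2 - (R - ε) ^ 2 * hsq j + R ^ 2 * hsq m
    nlinarith
  set D := Set.range r ∪ Set.range r' with hD
  have hrD : ∀ j, r j ∈ D := fun j => Or.inl ⟨j, rfl⟩
  have hr'D : ∀ j, r' j ∈ D := fun j => Or.inr ⟨j, rfl⟩
  have hfinj : Function.Injective (f ∘ r) := fun a b h =>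
    hrinj (hf.injOn (hrD a) (hrD b) h)
  have htriple : ∀ p a b c, p ∈ D → (f p ∈ convexHull ℝ {f (r a), f (r b), f (r c)} ↔
      p ∈ convexHull ℝ {r a, r b, r c}) := by
    intro p a b c hp
    rw [← mem_convexHull_image_iff_s13 hf hiso (S := {r a, r b, r c}) _ hp]
    · simp only [Set.image_insert_eq, Set.image_singleton]
    · rintro _ (rfl | rfl | rfl) <;> exact hrD _
  have hPrange : P = Set.range (f ∘ r) ∪ Set.range (f ∘ r') := by
    rw [← hf.image_eq, hD, Set.image_union, Set.range_comp, Set.range_comp]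
  rw [hPrange]
  refine supporting_line_of_crossing_diagonals hk (f ∘ r) (f ∘ r') i hfinj ?_ ?_ ?_ ?_ ?_ ?_
  · exact fun j m h => hr'ne j m (hf.injOn (hr'D j) (hrD m) h)
  · -- every outer point is the unique maximizer of a linear form among the outer points
    intro j S hS hj hmem
    rw [Set.range_comp] at hS
    obtain ⟨T, hT, rfl⟩ := Set.subset_image_iff.1 hS
    have hTD : T ⊆ D := fun x hx => Or.inl (hT hx)
    have hmem' := (mem_convexHull_image_iff_s13 hf hiso hTD (hrD j)).1 hmem
    let φ : (ℝ × ℝ) →ₗ[ℝ] ℝ :=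
      (u j).re • LinearMap.fst ℝ ℝ ℝ + (u j).im • LinearMap.snd ℝ ℝ ℝ
    have hφ : ∀ m, φ (r m) = R * ((u j).re * (u m).re + (u j).im * (u m).im) := fun m => by
      simp [φ, hr]; ring
    have hsub : convexHull ℝ T ⊆ {x | φ x < R} := by
      refine convexHull_min ?_ (convex_halfSpace_lt φ.isLinear _)
      intro x hx
      obtain ⟨m, rfl⟩ := hT hx
      have hne : u j ≠ u m := fun h => hj (by rw [huinj h]; exact Set.mem_image_of_mem f hx)
      have hpos : 0 < ((u j).re - (u m).re) ^ 2 + ((u j).im - (u m).im) ^ 2 := by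
        refine lt_of_le_of_ne (by positivity) fun h => hne (Complex.ext ?_ ?_) <;> nlinarith
      have := hsq j
      have := hsq m
      rw [Set.mem_ofPred_eq, hφ]
      exact mul_lt_of_lt_one_right hR (by nlinarith)
    have hlt : φ (r j) < R := hsub hmem'
    rw [hφ] at hlt
    have := hsq j
    nlinarith
  · intro j
    have hpair : f '' {r j, r (j + k)} = {f (r j), f (r (j + k))} := by
      rw [Set.image_insert_eq, Set.image_singleton]
    rw [← convexHull_pair, Function.comp_apply, Function.comp_apply, Function.comp_apply, ← hpair,
      mem_convexHull_image_iff_s13 hf hiso _ (hr'D j), convexHull_pair, hrk, hr'r]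
    · refine ⟨1 - ε / R / 2, ε / R / 2, by linarith, by linarith, by ring, ?_⟩
      module
    · rintro _ (rfl | rfl) <;> exact hrD _
  · intro a
    refine (htriple _ _ _ _ (hr'D i)).2 ?_
    have h0 : (0 : ℝ × ℝ) ∈ convexHull ℝ {r i, r a, r (a + k)} := by
      refine (convex_convexHull ℝ _).segment_subset (x := r a) (y := r (a + k))
        (subset_convexHull ℝ _ (by simp)) (subset_convexHull ℝ _ (by simp)) ?_
      rw [hrk]
      exact ⟨1 / 2, 1 / 2, by norm_num, by norm_num, by norm_num, by module⟩
    refine (convex_convexHull ℝ _).segment_subset (subset_convexHull ℝ _ (by simp)) h0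
      (x := r i) ?_
    exact ⟨1 - ε / R, ε / R, by linarith, hεR0.le, by ring, by rw [hr'r]; module⟩
  · -- the diagonal through `r j` has `r i` and `r (i + 1)` strictly on one side
    intro j h1 h2 h3 h4 hmem
    replace hmem := (htriple _ _ _ _ (hr'D j)).1 hmem
    have hkk : (k : ZMod (2 * k)) + k = 0 := by
      rw [← Nat.cast_add, ← two_mul, ZMod.natCast_self]
    have hs := stdAddChar_im_mul_im_succ_pos hk (m := i - j)
      (fun h => h1 (by linear_combination -h)) (fun h => h3 (by linear_combination -h))
      (fun h => h2 (by linear_combination -h)) (fun h => h4 (by linear_combination -h))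
    rw [← hu] at hs
    let φ : (ℝ × ℝ) →ₗ[ℝ] ℝ := (u (i - j)).im •
      ((u j).re • LinearMap.snd ℝ ℝ ℝ - (u j).im • LinearMap.fst ℝ ℝ ℝ)
    have hφ : ∀ m, φ (r m) = R * ((u (i - j)).im * (u (m - j)).im) := fun m => by
      have hm : u m = u j * u (m - j) := by rw [← AddChar.map_add_eq_mul, add_sub_cancel]
      simp only [φ, hr, hm, LinearMap.smul_apply, LinearMap.sub_apply, LinearMap.fst_apply,
        LinearMap.snd_apply, smul_eq_mul, Complex.mul_re, Complex.mul_im]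
      linear_combination R * (u (i - j)).im * (u (m - j)).im * hsq j
    have hφj : φ (r j) = 0 := by rw [hφ]; simp
    have hφi : 0 < φ (r i) := by
      rw [hφ]
      exact mul_pos hR (mul_self_pos.2 (left_ne_zero_of_mul hs.ne'))
    have hφi1 : 0 < φ (r (i + 1)) := by
      rw [hφ, show i + 1 - j = i - j + 1 by ring]
      exact mul_pos hR hs
    rw [convexHull_insert (by simp), convexHull_pair, mem_convexJoin] at hmem
    obtain ⟨x, rfl, z, hz, a, b, ha, hb, hab, hx⟩ := hmem
    have hφz : 0 < φ z :=
      (convex_halfSpace_gt φ.isLinear 0).segment_subset hφi hφi1 hz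
    have hb0 : b = 0 := by
      have := congrArg φ hx
      rw [hr'r, map_add, map_smul, map_smul, map_smul, hφj, smul_zero, smul_zero, zero_add,
        smul_eq_mul] at this
      exact (mul_eq_zero.1 this).resolve_right hφz.ne'
    obtain rfl : a = 1 := by linarith
    rw [hb0, one_smul, zero_smul, add_zero] at hx
    exact hr'ne j j hx.symm
  · intro j h1 h2 h3 h4 hmem
    replace hmem := (htriple _ _ _ _ (hr'D j)).1 hmem
    refine hvertex j (convexHull_mono ?_ hmem)
    have hk0 : (k : ZMod (2 * k)) ≠ 0 := fun h =>
      absurd (Nat.le_of_dvd (by omega) ((ZMod.natCast_eq_zero_iff _ _).1 h)) (by omega)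
    have hout : ∀ m, m ≠ j → r m ∈ D \ {r j, r' j} := fun m hm =>
      ⟨hrD m, by simp [hrinj.eq_iff, hm, (hr'ne j m).symm]⟩
    rintro _ (rfl | rfl | rfl)
    exacts [hout _ (by simpa using hk0), hout _ h1.symm, hout _ h2.symm]
end
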